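/- Let n ≥ 1. If 𝒢 is a null upper semi-continuous decomposition of a compact metric space X each of whose non-singleton elements is a recursively starlike-equivalent subset of X of filtration length ≤ n, then 𝒢 is strongly shrinkable, and the quotient map π : X → X/𝒢 is a strong near homeomorphism. -/

import Mathlib

open Metric Set Function

universe u v

/-- A collection of subsets of a (pseudo)metric space is *null* if for every `ε > 0`
only finitely many of its members have diameter `≥ ε`. -/
def IsNullCollection {X : Type u} [PseudoMetricSpace X] (𝒞 : Set (Set X)) : Prop :=
  ∀ ε : ℝ, 0 < ε → {C | C ∈ 𝒞 ∧ ε ≤ Metric.diam C}.Finite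

/-- An upper semi-continuous decomposition of a space `X`: a partition of `X` into
nonempty compact subsets such that the quotient map to the quotient space
(with the quotient topology) is a closed map. -/
def IsUSCDecomposition {X : Type u} [TopologicalSpace X] (𝒢 : Set (Set X)) : Prop :=
  (∀ G ∈ 𝒢, IsCompact G ∧ G.Nonempty) ∧
  (∀ x : X, ∃! G, G ∈ 𝒢 ∧ x ∈ G) ∧
  IsClosedMap (Quot.mk (fun x y : X => ∃ G ∈ 𝒢, x ∈ G ∧ y ∈ G))

/-- `f` maps `S` homeomorphically onto `T`. -/
def MapsHomeomorphicallyOnto {X : Type u} {Y : Type v} [TopologicalSpace X]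
    [TopologicalSpace Y] (f : X → Y) (S : Set X) (T : Set Y) : Prop :=
  ∃ e : S ≃ₜ T, ∀ x : S, (e x : Y) = f (x : X)

/-- A compact subset `A` of a metric space `X` is *squeezable* if for every null
upper semi-continuous decomposition `𝒢` of `X` with `A ∈ 𝒢`, every open neighborhood
`U` of `A` and every `δ > 0`, there is a homeomorphism `h : X → X` which is the identity
on `X − U`, with `diam (h '' A) < δ`, and such that for every `G ∈ 𝒢` either
`diam (h '' G) < δ` or `h` is the identity on `G`. -/
def Squeezable {X : Type u} [MetricSpace X] (A : Set X) : Prop :=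
  IsCompact A ∧
    ∀ 𝒢 : Set (Set X), IsUSCDecomposition 𝒢 → IsNullCollection 𝒢 → A ∈ 𝒢 →
      ∀ U : Set X, IsOpen U → A ⊆ U → ∀ δ : ℝ, 0 < δ →
        ∃ h : X ≃ₜ X, (∀ x ∈ Uᶜ, h x = x) ∧ Metric.diam (⇑h '' A) < δ ∧
          ∀ G ∈ 𝒢, Metric.diam (⇑h '' G) < δ ∨ ∀ x ∈ G, h x = x

/-- A compact subset `A` of a metric space `X` is *squashable* if for every null
upper semi-continuous decomposition `𝒢` of `X` with `A ∈ 𝒢`, every open neighborhood `U`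
of `A` and every `δ > 0`, there is a continuous map `f : X → X` in the closure (in `C(X,X)`)
of the set of homeomorphisms of `X` fixing `X − U` pointwise, such that `f '' A` is a
one-point set `{p}`, `f` maps `X − A` homeomorphically onto `X − {p}`, and for every
`G ∈ 𝒢` either `diam (f '' G) < δ` or `f` is the identity on `G`. -/
def Squashable {X : Type u} [MetricSpace X] (A : Set X) : Prop :=
  IsCompact A ∧
    ∀ 𝒢 : Set (Set X), IsUSCDecomposition 𝒢 → IsNullCollection 𝒢 → A ∈ 𝒢 →
      ∀ U : Set X, IsOpen U → A ⊆ U → ∀ δ : ℝ, 0 < δ →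
        ∃ (f : C(X, X)) (p : X),
          f ∈ closure ((fun h : X ≃ₜ X => (h : C(X, X))) ''
              {h : X ≃ₜ X | ∀ x ∈ Uᶜ, h x = x}) ∧
          ⇑f '' A = {p} ∧
          MapsHomeomorphicallyOnto (⇑f) Aᶜ ({p}ᶜ) ∧
          ∀ G ∈ 𝒢, Metric.diam (⇑f '' G) < δ ∨ ∀ x ∈ G, f x = x

/-- `π` injects over `C` if `π` is injective on `π ⁻¹' C`. -/
def InjectsOver {X : Type u} {Y : Type v} (π : X → Y) (C : Set Y) : Prop :=
  Set.InjOn π (π ⁻¹' C)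

/-- The strong shrinking criterion for an onto map `π : X → Y` between compact metric
spaces. -/
def SatisfiesStrongShrinkingCriterion {X : Type u} {Y : Type v} [MetricSpace X]
    [MetricSpace Y] (π : X → Y) : Prop :=
  ∀ δ : ℝ, 0 < δ → ∀ C : Set Y, IsClosed C → InjectsOver π C →
    ∃ h : X ≃ₜ X,
      (∀ y : Y, Metric.diam (⇑h '' (π ⁻¹' {y})) < δ) ∧
      (∀ x : X, dist (π x) (π (h.symm x)) < δ) ∧
      ∀ x ∈ π ⁻¹' C, h x = x

/-- `π : X → Y` is a strong near homeomorphism. -/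
def IsStrongNearHomeomorphism {X : Type u} {Y : Type v} [MetricSpace X]
    [MetricSpace Y] (π : X → Y) : Prop :=
  ∀ ε : ℝ, 0 < ε → ∀ C : Set Y, IsClosed C → InjectsOver π C →
    ∃ f : X ≃ₜ Y, (∀ x : X, dist (π x) (f x) < ε) ∧ ∀ x ∈ π ⁻¹' C, f x = π x

/-- A subset of `ℝⁿ` is starlike if it is compact and contains a point `x` such that the
segment from `x` to any of its points lies in it. -/
def IsStarlike {n : ℕ} (A : Set (EuclideanSpace ℝ (Fin n))) : Prop :=
  IsCompact A ∧ ∃ x ∈ A, ∀ y ∈ A, segment ℝ x y ⊆ A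

/-- A subset `A` of a space `X` is starlike-equivalent if some open neighborhood of `A`
embeds onto an open subset of some `ℝⁿ` (`n ≥ 1`) carrying `A` onto a starlike set. -/
def IsStarlikeEquivalent {X : Type u} [TopologicalSpace X] (A : Set X) : Prop :=
  ∃ n : ℕ, 1 ≤ n ∧ ∃ U : Set X, IsOpen U ∧ A ⊆ U ∧
    ∃ e : U → EuclideanSpace ℝ (Fin n), Topology.IsEmbedding e ∧ IsOpen (Set.range e) ∧
      IsStarlike (e '' {x : U | (x : X) ∈ A})

/-- The image `A/B` of `A` in the quotient `X/B` of `X` obtained by identifying the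
compact set `B ⊆ A` to a point is a squeezable subset of `X/B`, for some
(equivalently, by metric-independence, any) metric inducing the quotient topology.
The quotient `X/B` is modelled by an arbitrary compact metric space `Y` together with a
continuous surjection `π : X → Y` whose fibers are `B` and the singletons of `X − B`
(such a map from the compact space `X` to the metrizable space `Y` is automatically a
closed quotient map, so `Y` is `X/B` with a metric inducing the quotient topology). -/
def SqueezableInQuotient {X : Type u} [MetricSpace X] (B A : Set X) : Prop :=
  ∃ (Y : Type u) (mY : MetricSpace Y) (π : X → Y),
    letI := mY
    Continuous π ∧ Function.Surjective π ∧
      (∀ x y : X, π x = π y ↔ x = y ∨ (x ∈ B ∧ y ∈ B)) ∧ Squeezable (π '' A)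

/-- `A/B` is a squashable subset of `X/B`; see `SqueezableInQuotient`. -/
def SquashableInQuotient {X : Type u} [MetricSpace X] (B A : Set X) : Prop :=
  ∃ (Y : Type u) (mY : MetricSpace Y) (π : X → Y),
    letI := mY
    Continuous π ∧ Function.Surjective π ∧
      (∀ x y : X, π x = π y ↔ x = y ∨ (x ∈ B ∧ y ∈ B)) ∧ Squashable (π '' A)

/-- `A/B` is a starlike-equivalent subset of `X/B`; see `SqueezableInQuotient`. -/
def StarlikeEquivalentInQuotient {X : Type u} [MetricSpace X] (B A : Set X) : Prop :=
  ∃ (Y : Type u) (mY : MetricSpace Y) (π : X → Y),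
    letI := mY
    Continuous π ∧ Function.Surjective π ∧
      (∀ x y : X, π x = π y ↔ x = y ∨ (x ∈ B ∧ y ∈ B)) ∧ IsStarlikeEquivalent (π '' A)

/-- `A` is recursively squeezable of filtration length `≤ n`: there is a chain
`A₁ ⊆ ⋯ ⊆ A_{n+1} = A` of compact subsets of `X` with `A₁` squeezable in `X` and
`A_{i+1}/A_i` squeezable in `X/A_i` for each `i`. -/
def RecursivelySqueezableOfLength {X : Type u} [MetricSpace X] (n : ℕ) (A : Set X) :
    Prop :=
  ∃ F : Fin (n + 1) → Set X,
    (∀ i, IsCompact (F i)) ∧ Monotone F ∧ F (Fin.last n) = A ∧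
    Squeezable (F 0) ∧ ∀ i : Fin n, SqueezableInQuotient (F i.castSucc) (F i.succ)

/-- `A` is recursively squeezable: recursively squeezable of filtration length `≤ n`
for some `n ≥ 0`. -/
def RecursivelySqueezable {X : Type u} [MetricSpace X] (A : Set X) : Prop :=
  ∃ n : ℕ, RecursivelySqueezableOfLength n A

/-- `A` is recursively squashable of filtration length `≤ n`. -/
def RecursivelySquashableOfLength {X : Type u} [MetricSpace X] (n : ℕ) (A : Set X) :
    Prop :=
  ∃ F : Fin (n + 1) → Set X,
    (∀ i, IsCompact (F i)) ∧ Monotone F ∧ F (Fin.last n) = A ∧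
    Squashable (F 0) ∧ ∀ i : Fin n, SquashableInQuotient (F i.castSucc) (F i.succ)

/-- `A` is recursively squashable. -/
def RecursivelySquashable {X : Type u} [MetricSpace X] (A : Set X) : Prop :=
  ∃ n : ℕ, RecursivelySquashableOfLength n A

/-- `A` is recursively starlike-equivalent of filtration length `≤ n`. -/
def RecursivelyStarlikeEquivalentOfLength {X : Type u} [MetricSpace X] (n : ℕ)
    (A : Set X) : Prop :=
  ∃ F : Fin (n + 1) → Set X,
    (∀ i, IsCompact (F i)) ∧ Monotone F ∧ F (Fin.last n) = A ∧
    IsStarlikeEquivalent (F 0) ∧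
    ∀ i : Fin n, StarlikeEquivalentInQuotient (F i.castSucc) (F i.succ)

/-- `A` is recursively starlike-equivalent. -/
def RecursivelyStarlikeEquivalent {X : Type u} [MetricSpace X] (A : Set X) : Prop :=
  ∃ n : ℕ, RecursivelyStarlikeEquivalentOfLength n A

/-- A space of homeomorphisms of `X` in which the point preimages of `π` can be shrunk without
moving the composite to `Y` much yields homeomorphisms onto `Y`. -/
theorem exists_homeomorph_approximating_of_shrinking {X : Type u} {Y : Type v} [MetricSpace X]
    [CompactSpace X] [MetricSpace Y] [CompactSpace Y] {π : X → Y} (hπ : Continuous π)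
    (hsurj : Function.Surjective π) (H : Set (X ≃ₜ X))
    (hH : ∀ h ∈ H, ∀ ε : ℝ, 0 < ε → ∃ h' ∈ H, (∀ x y, π x = π y → dist (h' x) (h' y) < ε) ∧
      ∀ x, dist (π (h'.symm x)) (π (h.symm x)) < ε)
    {h₀ : X ≃ₜ X} (hh₀ : h₀ ∈ H) {ε : ℝ} (hε : 0 < ε) :
    ∃ g : X ≃ₜ Y, (∀ x, dist (g x) (π (h₀.symm x)) < ε) ∧
      ∀ η : ℝ, 0 < η → ∃ h ∈ H, ∀ x, dist (g x) (π (h.symm x)) < η := by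
  let Φ : (X ≃ₜ X) → C(X, Y) := fun h => ⟨fun x => π (h.symm x), hπ.comp h.symm.continuous⟩
  let E : Set C(X, Y) := closure (Φ '' H)
  have : CompleteSpace E := isClosed_closure.completeSpace_coe
  let O : ℕ → Set C(X, Y) := fun n => {φ | ∀ x y, 1 / ((n : ℝ) + 1) ≤ dist x y → φ x ≠ φ y}
  have hO : ∀ n, IsOpen (O n) := by
    intro n
    rw [Metric.isOpen_iff]
    intro φ hφ
    let T : Set (X × X) := {p | 1 / ((n : ℝ) + 1) ≤ dist p.1 p.2}
    have hT : IsCompact T := (isClosed_le continuous_const continuous_dist).isCompact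
    rcases T.eq_empty_or_nonempty with hTe | hTn
    · refine ⟨1, one_pos, fun ψ _ x y hxy => ?_⟩
      have : (x, y) ∈ T := hxy
      simp [hTe] at this
    · obtain ⟨p, hp, hmin⟩ := hT.exists_isMinOn hTn
        (f := fun p => dist (φ p.1) (φ p.2)) (by fun_prop)
      have hpos : 0 < dist (φ p.1) (φ p.2) := dist_pos.2 (hφ _ _ hp)
      refine ⟨dist (φ p.1) (φ p.2) / 2, half_pos hpos, fun ψ hψ x y hxy hEq => ?_⟩
      have h1 := isMinOn_iff.1 hmin (x, y) hxy
      have h2 := (ContinuousMap.dist_lt_iff (half_pos hpos)).1 (mem_ball.1 hψ)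
      have h3 := dist_triangle4 (φ x) (ψ x) (ψ y) (φ y)
      have h4 : dist (ψ x) (ψ y) = 0 := by rw [hEq, dist_self]
      have h5 := h2 x
      have h6 := h2 y
      rw [dist_comm] at h5
      linarith
  have hd : Dense (⋂ n, ((↑) : E → C(X, Y)) ⁻¹' O n) := by
    refine dense_iInter_of_isOpen_nat (fun n => (hO n).preimage continuous_subtype_val) ?_
    intro n
    rw [Metric.dense_iff]
    rintro ⟨φ, hφ⟩ r hr
    obtain ⟨_, ⟨h, hh, rfl⟩, hφh⟩ := Metric.mem_closure_iff.1 hφ (r / 2) (half_pos hr)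
    obtain ⟨h', hh', hsmall, hclose⟩ := hH h hh (min (r / 2) (1 / ((n : ℝ) + 1)))
      (lt_min (half_pos hr) (by positivity))
    refine ⟨⟨Φ h', subset_closure ⟨h', hh', rfl⟩⟩, ?_, ?_⟩
    · rw [mem_ball, Subtype.dist_eq]
      have h1 : dist (Φ h') (Φ h) < r / 2 := (ContinuousMap.dist_lt_iff (half_pos hr)).2
        fun x => (hclose x).trans_le (min_le_left _ _)
      have h2 := dist_triangle (Φ h') (Φ h) φ
      rw [dist_comm (Φ h) φ] at h2
      change dist (Φ h') φ < r
      linarith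
    · intro x y hxy hEq
      have := hsmall _ _ hEq
      simp only [Homeomorph.apply_symm_apply] at this
      exact absurd (this.trans_le (min_le_right _ _)) (not_lt.2 hxy)
  obtain ⟨⟨φ, hφE⟩, hφball, hφO⟩ := Metric.dense_iff.1 hd ⟨Φ h₀, subset_closure ⟨h₀, hh₀, rfl⟩⟩ ε hε
  have hclose : ∀ η : ℝ, 0 < η → ∃ h ∈ H, ∀ x, dist (φ x) (π (h.symm x)) < η := by
    intro η hη
    obtain ⟨_, ⟨h, hh, rfl⟩, hφh⟩ := Metric.mem_closure_iff.1 hφE η hη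
    exact ⟨h, hh, (ContinuousMap.dist_lt_iff hη).1 hφh⟩
  have hinj : Function.Injective φ := by
    intro x y hxy
    by_contra hne
    obtain ⟨n, hn⟩ := exists_nat_one_div_lt (dist_pos.2 hne)
    exact (mem_iInter.1 hφO n) x y hn.le hxy
  have hsur : Function.Surjective φ := by
    intro y
    have hcl : IsClosed (range φ) := (isCompact_range φ.continuous).isClosed
    have : y ∈ closure (range φ) := by
      rw [Metric.mem_closure_iff]
      intro η hη
      obtain ⟨h, -, hh⟩ := hclose η hη
      obtain ⟨x, rfl⟩ := hsurj y
      refine ⟨φ (h x), mem_range_self _, ?_⟩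
      have := hh (h x)
      rwa [Homeomorph.symm_apply_apply, dist_comm] at this
    rwa [hcl.closure_eq] at this
  let g : X ≃ₜ Y := Continuous.homeoOfEquivCompactToT2 (f := Equiv.ofBijective φ ⟨hinj, hsur⟩)
    φ.continuous
  refine ⟨g, ?_, hclose⟩
  rw [mem_ball, Subtype.dist_eq] at hφball
  exact (ContinuousMap.dist_lt_iff hε).1 hφball

/-- Near a closed set, the members of a null collection of closed sets disjoint from it
are small. -/
theorem IsNullCollection.exists_isOpen_diam_lt {X : Type u} [MetricSpace X] {𝒢 : Set (Set X)}
    (hnull : IsNullCollection 𝒢) {A : Set X} (h𝒢 : ∀ G ∈ 𝒢, IsClosed G ∧ Disjoint G A)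
    {ε : ℝ} (hε : 0 < ε) :
    ∃ O : Set X, IsOpen O ∧ A ⊆ O ∧ ∀ G ∈ 𝒢, ∀ x ∈ G, x ∈ O → Metric.diam G < ε := by
  refine ⟨(⋃₀ {G | G ∈ 𝒢 ∧ ε ≤ Metric.diam G})ᶜ, ?_, ?_, ?_⟩
  · rw [sUnion_eq_biUnion]
    exact ((hnull ε hε).isClosed_biUnion fun G hG => (h𝒢 G hG.1).1).isOpen_compl
  · rintro a ha ⟨G, hG, haG⟩
    exact disjoint_left.1 (h𝒢 G hG.1).2 haG ha
  · intro G hG x hx hxO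
    by_contra hlt
    exact hxO ⟨G, ⟨hG, not_lt.1 hlt⟩, hx⟩

/-- The image of a null collection under a continuous map from a compact space is null. -/
theorem IsNullCollection.image {X : Type u} {Y : Type v} [MetricSpace X] [CompactSpace X]
    [MetricSpace Y] {𝒢 : Set (Set X)} (hnull : IsNullCollection 𝒢) {f : X → Y}
    (hf : Continuous f) : IsNullCollection ((fun G => f '' G) '' 𝒢) := by
  intro ε hε
  obtain ⟨η, hη, hfη⟩ := Metric.uniformContinuous_iff.1
    (CompactSpace.uniformContinuous_of_continuous hf) (ε / 2) (half_pos hε)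
  refine ((hnull η hη).image (fun G => f '' G)).subset ?_
  rintro _ ⟨⟨G, hG, rfl⟩, hdiam⟩
  refine ⟨G, ⟨hG, ?_⟩, rfl⟩
  by_contra hlt
  have : Metric.diam (f '' G) ≤ ε / 2 := by
    refine Metric.diam_le_of_forall_dist_le (half_pos hε).le ?_
    rintro _ ⟨x, hx, rfl⟩ _ ⟨y, hy, rfl⟩
    exact (hfη ((Metric.dist_le_diam_of_mem (Metric.isBounded_of_compactSpace) hx hy).trans_lt
      (not_le.1 hlt))).le
  simp only at hdiam
  linarith

/-- `A` can be shrunk by homeomorphisms supported near `A` which barely increase the diameters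
of the members of any given null collection of closed sets disjoint from `A`. -/
def IsNullShrinkable {X : Type u} [MetricSpace X] (A : Set X) : Prop :=
  ∀ 𝒢 : Set (Set X), IsNullCollection 𝒢 → (∀ G ∈ 𝒢, IsClosed G ∧ Disjoint G A) →
    ∀ U : Set X, IsOpen U → A ⊆ U → ∀ δ : ℝ, 0 < δ →
      ∃ h : X ≃ₜ X, (∀ x ∉ U, h x = x) ∧ Metric.diam (h '' A) ≤ δ ∧
        ∀ G ∈ 𝒢, Metric.diam (h '' G) ≤ Metric.diam G + δ

theorem Homeomorph.symm_apply_eq_self {X : Type u} [TopologicalSpace X] {h : X ≃ₜ X} {x : X}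
    (hx : h x = x) : h.symm x = x := by
  rw [Homeomorph.symm_apply_eq, hx]

theorem Homeomorph.apply_mem_of_forall_notMem {X : Type u} [TopologicalSpace X] {h : X ≃ₜ X}
    {U : Set X} (hU : ∀ x ∉ U, h x = x) {x : X} (hx : x ∈ U) : h x ∈ U := by
  by_contra hn
  exact hn (by rwa [h.injective (hU _ hn)])

theorem Metric.diam_image_le_add {X : Type u} {Y : Type v} [MetricSpace Y] [CompactSpace Y]
    {f g : X → Y} {η : ℝ} (hη : 0 ≤ η) (hfg : ∀ x, dist (f x) (g x) ≤ η) (G : Set X) :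
    Metric.diam (f '' G) ≤ Metric.diam (g '' G) + 2 * η := by
  refine Metric.diam_le_of_forall_dist_le (by positivity) ?_
  rintro _ ⟨x, hx, rfl⟩ _ ⟨y, hy, rfl⟩
  have h1 := dist_triangle4 (f x) (g x) (g y) (f y)
  have h2 := hfg x
  have h3 := hfg y
  have h4 := Metric.dist_le_diam_of_mem (Metric.isBounded_of_compactSpace)
    (mem_image_of_mem g hx) (mem_image_of_mem g hy)
  rw [dist_comm] at h3
  linarith

theorem IsNullShrinkable.exists_homeomorph_quotient {X : Type u} {Y : Type v} [MetricSpace X]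
    [CompactSpace X] [MetricSpace Y] [CompactSpace Y] {B : Set X} (hB : IsNullShrinkable B)
    (hBn : B.Nonempty) {π : X → Y} (hπ : Continuous π) (hsurj : Function.Surjective π)
    (hfib : ∀ x y, π x = π y ↔ x = y ∨ (x ∈ B ∧ y ∈ B))
    {𝒢 : Set (Set X)} (hnull : IsNullCollection 𝒢) (h𝒢 : ∀ G ∈ 𝒢, IsClosed G ∧ Disjoint G B)
    {U : Set X} (hU : IsOpen U) (hBU : B ⊆ U) {δ : ℝ} (hδ : 0 < δ) :
    ∃ g : X ≃ₜ Y, ∀ ε : ℝ, 0 < ε → ∃ h : X ≃ₜ X, (∀ x ∉ U, h x = x) ∧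
      (∀ G ∈ 𝒢, Metric.diam (h '' G) ≤ Metric.diam G + δ) ∧
      ∀ x, dist (h x) (g.symm (π x)) < ε := by
  let H : Set (X ≃ₜ X) := {h | (∀ x ∉ U, h x = x) ∧
    ∀ G ∈ 𝒢, Metric.diam (h '' G) ≤ Metric.diam G + δ}
  have hrefl : Homeomorph.refl X ∈ H := by
    refine ⟨fun x _ => rfl, fun G _ => ?_⟩
    simp [hδ.le]
  obtain ⟨b, hb⟩ := hBn
  have hdense : ∀ h ∈ H, ∀ ε : ℝ, 0 < ε → ∃ h' ∈ H, (∀ x y, π x = π y → dist (h' x) (h' y) < ε) ∧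
      ∀ x, dist (π (h'.symm x)) (π (h.symm x)) < ε := by
    intro h hh ε hε
    obtain ⟨η, hη, hhη⟩ := Metric.uniformContinuous_iff.1
      (CompactSpace.uniformContinuous_of_continuous h.continuous) (min ε δ) (lt_min hε hδ)
    obtain ⟨O, hO, hBO, hO𝒢⟩ := hnull.exists_isOpen_diam_lt h𝒢 (half_pos hη)
    obtain ⟨k, hkV, hkB, hk𝒢⟩ := hB 𝒢 hnull h𝒢 (U ∩ O ∩ π ⁻¹' ball (π b) (ε / 2))
      ((hU.inter hO).inter (isOpen_ball.preimage hπ))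
      (fun x hx => ⟨⟨hBU hx, hBO hx⟩, by
        rw [mem_preimage, (hfib x b).2 (Or.inr ⟨hx, hb⟩)]
        exact mem_ball_self (half_pos hε)⟩) (η / 3) (by positivity)
    refine ⟨k.trans h, ⟨?_, ?_⟩, ?_, ?_⟩
    · intro x hx
      simp [hkV x (fun hx' => hx hx'.1.1), hh.1 x hx]
    · intro G hG
      by_cases hGO : ∃ x ∈ G, x ∈ O
      · obtain ⟨x, hx, hxO⟩ := hGO
        have h1 := hO𝒢 G hG x hx hxO
        have h2 := hk𝒢 G hG
        refine Metric.diam_le_of_forall_dist_le (by positivity) ?_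
        rintro _ ⟨y, hy, rfl⟩ _ ⟨z, hz, rfl⟩
        have h3 := Metric.dist_le_diam_of_mem (Metric.isBounded_of_compactSpace)
          (mem_image_of_mem k hy) (mem_image_of_mem k hz)
        have h4 := hhη (show dist (k y) (k z) < η by linarith)
        have h5 : 0 ≤ Metric.diam G := Metric.diam_nonneg
        exact (h4.le.trans (min_le_right _ _)).trans (by linarith)
      · have : (k.trans h) '' G = h '' G := by
          refine image_congr fun x hx => ?_
          rw [Homeomorph.trans_apply, hkV x fun hx' => hGO ⟨x, hx, hx'.1.2⟩]
        rw [this]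
        exact hh.2 G hG
    · intro x y hxy
      rcases (hfib x y).1 hxy with rfl | ⟨hx, hy⟩
      · simpa using hε
      · have h3 := Metric.dist_le_diam_of_mem (Metric.isBounded_of_compactSpace)
          (mem_image_of_mem k hx) (mem_image_of_mem k hy)
        exact (hhη (show dist (k x) (k y) < η by linarith)).trans_le (min_le_left _ _)
    · intro x
      simp only [Homeomorph.symm_trans_apply]
      by_cases hx : h.symm x ∈ U ∩ O ∩ π ⁻¹' ball (π b) (ε / 2)
      · have h1 := Homeomorph.apply_mem_of_forall_notMem
          (fun y hy => Homeomorph.symm_apply_eq_self (hkV y hy)) hx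
        have h2 := mem_ball.1 hx.2
        have h3 := mem_ball.1 h1.2
        have h4 := dist_triangle_right (π (k.symm (h.symm x))) (π (h.symm x)) (π b)
        linarith
      · rw [Homeomorph.symm_apply_eq_self (hkV _ hx), dist_self]
        exact hε
  obtain ⟨g, -, hg⟩ :=
    exists_homeomorph_approximating_of_shrinking hπ hsurj H hdense hrefl one_pos
  refine ⟨g, fun ε hε => ?_⟩
  obtain ⟨η, hη, hgη⟩ := Metric.uniformContinuous_iff.1
    (CompactSpace.uniformContinuous_of_continuous g.symm.continuous) ε hε
  obtain ⟨h, hh, hclose⟩ := hg η hη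
  refine ⟨h, hh.1, hh.2, fun x => ?_⟩
  have := hgη (hclose (h x))
  simpa using this

theorem IsNullShrinkable.of_quotient {X : Type u} {Y : Type v} [MetricSpace X]
    [CompactSpace X] [MetricSpace Y] [CompactSpace Y] {A B : Set X} (hB : IsNullShrinkable B)
    (hBn : B.Nonempty) (hBA : B ⊆ A) {π : X → Y} (hπ : Continuous π)
    (hsurj : Function.Surjective π) (hfib : ∀ x y, π x = π y ↔ x = y ∨ (x ∈ B ∧ y ∈ B))
    (hA : ∀ g : X ≃ₜ Y, IsNullShrinkable ((fun x => g.symm (π x)) '' A)) :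
    IsNullShrinkable A := by
  intro 𝒢 hnull h𝒢 U hU hAU δ hδ
  obtain ⟨g, hg⟩ := hB.exists_homeomorph_quotient hBn hπ hsurj hfib hnull
    (fun G hG => ⟨(h𝒢 G hG).1, (h𝒢 G hG).2.mono_right hBA⟩) hU (hBA.trans hAU)
    (show 0 < δ / 4 by positivity)
  set f : X → X := fun x => g.symm (π x) with hf
  have hfc : Continuous f := g.symm.continuous.comp hπ
  have hffib : ∀ x y, f x = f y ↔ x = y ∨ (x ∈ B ∧ y ∈ B) := fun x y => by
    simp [hf, hfib]
  have hfU : ∀ x ∉ U, f x = x := by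
    intro x hx
    by_contra hne
    obtain ⟨h, hhU, -, hh⟩ := hg _ (dist_pos.2 (Ne.symm hne))
    have := hh x
    rw [hhU x hx] at this
    exact lt_irrefl _ this
  have hf𝒢 : ∀ G ∈ 𝒢, Metric.diam (f '' G) ≤ Metric.diam G + δ / 2 := by
    intro G hG
    obtain ⟨h, -, hh𝒢, hh⟩ := hg (δ / 8) (by positivity)
    have h1 := Metric.diam_image_le_add (f := f) (g := h) (show 0 ≤ δ / 8 by positivity)
      (fun x => by rw [dist_comm]; exact (hh x).le) G
    have h2 := hh𝒢 G hG
    linarith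
  have hdisj : ∀ G ∈ (fun G => f '' G) '' 𝒢, IsClosed G ∧ Disjoint G (f '' A) := by
    rintro _ ⟨G, hG, rfl⟩
    refine ⟨((h𝒢 G hG).1.isCompact.image hfc).isClosed, disjoint_left.2 ?_⟩
    rintro _ ⟨x, hx, rfl⟩ ⟨a, ha, hax⟩
    rcases (hffib a x).1 hax with rfl | ⟨-, hxB⟩
    · exact disjoint_left.1 (h𝒢 G hG).2 hx ha
    · exact disjoint_left.1 (h𝒢 G hG).2 hx (hBA hxB)
  have hfA : f '' A ⊆ U := by
    rintro _ ⟨a, ha, rfl⟩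
    by_contra hn
    rcases (hffib _ _).1 (hfU _ hn) with h | ⟨h, -⟩
    · exact hn (h.symm ▸ hAU ha)
    · exact hn (hAU (hBA h))
  obtain ⟨k, hkU, hkA, hk𝒢⟩ := hA g _ (hnull.image hfc) hdisj U hU hfA (δ / 4) (by positivity)
  obtain ⟨η, hη, hkη⟩ := Metric.uniformContinuous_iff.1
    (CompactSpace.uniformContinuous_of_continuous k.continuous) (δ / 8) (by positivity)
  obtain ⟨h, hhU, -, hh⟩ := hg η hη
  have hclose : ∀ G : Set X,
      Metric.diam (h.trans k '' G) ≤ Metric.diam (k '' (f '' G)) + 2 * (δ / 8) := by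
    intro G
    rw [← image_comp]
    exact Metric.diam_image_le_add (by positivity) (fun x => (hkη (hh x)).le) G
  refine ⟨h.trans k, ?_, ?_, ?_⟩
  · intro x hx
    simp [hhU x hx, hkU x hx]
  · have := hclose A
    linarith
  · intro G hG
    have h1 := hclose G
    have h2 := hk𝒢 _ ⟨G, hG, rfl⟩
    have h3 := hf𝒢 G hG
    simp only at h2
    linarith

/-- A monotone function rising from `0` to a given height near `0`, which rises only by a bounded
amount across each pair of a relation that is controlled at `0`. -/
theorem exists_monotone_slowly_increasing {Q : ℝ → ℝ → Prop}
    (hQ : ∀ r : ℝ, 0 < r → ∃ s : ℝ, 0 < s ∧ ∀ a b, Q a b → a < s → b < r)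
    {r δ : ℝ} (hr : 0 < r) (hδ : 0 < δ) (j : ℕ) :
    ∃ (σ : ℝ → ℝ) (s : ℝ), 0 < s ∧ s ≤ r ∧ Continuous σ ∧ Monotone σ ∧ (∀ a ≤ s, σ a = 0) ∧
      (∀ a, r ≤ a → σ a = j * δ) ∧ (∀ a b, Q a b → σ b ≤ σ a + 2 * δ) ∧
      ∀ a b, Q a b → a < s → σ b ≤ δ := by
  induction j with
  | zero =>
    exact ⟨fun _ => 0, r, hr, le_rfl, continuous_const, monotone_const, fun _ _ => rfl,
      fun _ _ => by simp, fun _ _ _ => by linarith, fun _ _ _ _ => hδ.le⟩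
  | succ j ih =>
    obtain ⟨σ, s, hs, hsr, hσc, hσm, hσ0, hσr, hσQ, hσs⟩ := ih
    obtain ⟨t, ht, hQt⟩ := hQ s hs
    let u := min t (s / 2)
    have hu : 0 < u := lt_min ht (half_pos hs)
    have hus : u < s := (min_le_right _ _).trans_lt (half_lt_self hs)
    let ψ : ℝ → ℝ := fun a => max 0 (min 1 ((a - u) / (s - u)))
    have hψ0 : ∀ a ≤ u, ψ a = 0 := fun a ha =>
      max_eq_left ((min_le_right _ _).trans
        (div_nonpos_of_nonpos_of_nonneg (by linarith) (by linarith)))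
    have hψ1 : ∀ a, s ≤ a → ψ a = 1 := fun a ha => by
      have : 1 ≤ (a - u) / (s - u) := (one_le_div (by linarith)).2 (by linarith)
      simp [ψ, min_eq_left this]
    have hψnn : ∀ a, 0 ≤ ψ a := fun a => le_max_left _ _
    have hψle : ∀ a, ψ a ≤ 1 := fun a => max_le zero_le_one (min_le_left _ _)
    have hψm : Monotone ψ := by
      intro a b hab
      refine max_le_max le_rfl (min_le_min le_rfl ?_)
      exact div_le_div_of_nonneg_right (by linarith) (by linarith)
    have hσnn : ∀ a, 0 ≤ σ a := fun a => by
      rcases le_total a s with h | h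
      · exact (hσ0 a h).ge
      · exact (hσ0 s le_rfl).ge.trans (hσm h)
    refine ⟨fun a => σ a + δ * ψ a, u, hu, hus.le.trans hsr, by fun_prop, ?_, ?_, ?_, ?_, ?_⟩
    · exact hσm.add (hψm.const_mul hδ.le)
    · intro a ha
      simp [hσ0 a (ha.trans hus.le), hψ0 a ha]
    · intro a ha
      simp only [hσr a ha, hψ1 a (hsr.trans ha)]
      push_cast
      ring
    · intro a b hab
      have h1 : δ * ψ b ≤ δ := mul_le_of_le_one_right hδ.le (hψle b)
      have h2 : 0 ≤ δ * ψ a := mul_nonneg hδ.le (hψnn a)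
      have h3 := hσnn a
      rcases lt_or_ge a s with h | h
      · have := hσs a b hab h
        linarith
      · have := hσQ a b hab
        simp only [hψ1 a h]
        linarith
    · intro a b hab ha
      have h1 : δ * ψ b ≤ δ := mul_le_of_le_one_right hδ.le (hψle b)
      have h2 := hσ0 b (hQt a b hab (ha.trans_le (min_le_left _ _))).le
      linarith

/-- The distance to a set which is starlike about the origin does not decrease along rays. -/
theorem infDist_smul_le_of_starConvex {E : Type*} [NormedAddCommGroup E] [NormedSpace ℝ E]
    {K : Set E} (hK : StarConvex ℝ 0 K) {t : ℝ} (ht : 0 ≤ t) (ht1 : t ≤ 1) (x : E) :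
    Metric.infDist (t • x) K ≤ Metric.infDist x K := by
  rcases K.eq_empty_or_nonempty with rfl | hne
  · simp
  refine (Metric.le_infDist hne).2 fun y hy => ?_
  calc Metric.infDist (t • x) K ≤ dist (t • x) (t • y) :=
        Metric.infDist_le_dist_of_mem (hK.smul_mem hy ht ht1)
    _ = t * dist x y := by rw [dist_smul₀, Real.norm_of_nonneg ht]
    _ ≤ dist x y := mul_le_of_le_one_left dist_nonneg ht1

/-- Rescaling each vector `x` by a positive factor, bounded below, so that norms strictly increase
along rays, is a bijection. -/
theorem bijective_smul_of_strictMono_rays {E : Type*} [NormedAddCommGroup E] [NormedSpace ℝ E]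
    {c : E → ℝ} (hc : Continuous c) {s : ℝ} (hs : 0 < s) (hsc : ∀ x, s ≤ c x)
    (hmono : ∀ x ≠ 0, ∀ t : ℝ, 0 < t → t < 1 → c (t • x) * t < c x) :
    Function.Bijective fun x => c x • x := by
  have hpos : ∀ x, 0 < c x := fun x => hs.trans_le (hsc x)
  have hlt : ∀ x y, c x • x = c y • y → ¬ c x < c y := by
    intro x y hxy hcc
    have hy : y = (c x / c y) • x := by
      rw [div_eq_inv_mul, mul_smul, hxy, smul_smul, inv_mul_cancel₀ (hpos y).ne', one_smul]
    have hx : x ≠ 0 := by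
      rintro rfl
      rw [smul_zero] at hy
      exact hcc.ne (by rw [hy])
    have h := hmono x hx (c x / c y) (div_pos (hpos x) (hpos y)) ((div_lt_one (hpos y)).2 hcc)
    rw [← hy, mul_div_cancel₀ _ (hpos y).ne'] at h
    exact lt_irrefl _ h
  constructor
  · intro x y hxy
    have hcc : c x = c y := le_antisymm (not_lt.1 (hlt y x hxy.symm)) (not_lt.1 (hlt x y hxy))
    have hxy' : c x • x = c y • y := hxy
    rw [← hcc] at hxy'
    exact smul_right_injective E (hpos x).ne' hxy'
  · intro z
    have hcont : ContinuousOn (fun t : ℝ => c (t • z) * t) (Icc 0 s⁻¹) := by fun_prop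
    have h1 : (1 : ℝ) ∈ Icc (c ((0 : ℝ) • z) * 0) (c (s⁻¹ • z) * s⁻¹) := by
      refine ⟨by simp, ?_⟩
      rw [← div_eq_mul_inv]
      exact (one_le_div hs).2 (hsc _)
    obtain ⟨t, -, ht⟩ := intermediate_value_Icc (inv_nonneg.2 hs.le) hcont h1
    refine ⟨t • z, ?_⟩
    simp only at ht
    simp only [smul_smul, ht, one_smul]

/-- Truncating vectors to given norms. -/
theorem norm_truncate_sub_truncate_le {E : Type*} [NormedAddCommGroup E] [NormedSpace ℝ E]
    {p q : ℝ} (hp : 0 < p) (hq : 0 < q) (x y : E) :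
    ‖(p / max p ‖x‖) • x - (q / max q ‖y‖) • y‖ ≤ 2 * ‖x - y‖ + |p - q| := by
  have hx : 0 < max p ‖x‖ := hp.trans_le (le_max_left _ _)
  have hy : 0 < max q ‖y‖ := hq.trans_le (le_max_left _ _)
  set a := p / max p ‖x‖ with ha
  set b := q / max q ‖y‖ with hb
  have ha0 : 0 ≤ a := (div_pos hp hx).le
  have ha1 : a ≤ 1 := (div_le_one hx).2 (le_max_left _ _)
  have hpy : 0 < max p ‖y‖ := hp.trans_le (le_max_left _ _)
  have hmin : ∀ u : ℝ, 0 < max u ‖y‖ → u / max u ‖y‖ * ‖y‖ = min u ‖y‖ := by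
    intro u hu
    rw [div_mul_eq_mul_div, ← min_mul_max u ‖y‖, mul_div_cancel_right₀ _ hu.ne']
  have hsame : |(a - p / max p ‖y‖) * ‖y‖| ≤ ‖x - y‖ := by
    have hid : (a - p / max p ‖y‖) * ‖y‖ =
        a * (‖y‖ / max p ‖y‖) * (max p ‖y‖ - max p ‖x‖) := by
      rw [ha]
      field_simp
    have hy1 : ‖y‖ / max p ‖y‖ ≤ 1 := (div_le_one hpy).2 (le_max_right _ _)
    have hy0 : 0 ≤ ‖y‖ / max p ‖y‖ := div_nonneg (norm_nonneg _) hpy.le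
    rw [hid, abs_mul, abs_of_nonneg (mul_nonneg ha0 hy0)]
    calc a * (‖y‖ / max p ‖y‖) * |max p ‖y‖ - max p ‖x‖|
        ≤ |max p ‖y‖ - max p ‖x‖| := mul_le_of_le_one_left (abs_nonneg _) (mul_le_one₀ ha1 hy0 hy1)
      _ ≤ |‖y‖ - ‖x‖| := by
        simpa using abs_max_sub_max_le_max p ‖y‖ p ‖x‖
      _ ≤ ‖x - y‖ := by
        rw [abs_sub_comm]
        exact abs_norm_sub_norm_le x y
  have hdiff : |(p / max p ‖y‖ - b) * ‖y‖| ≤ |p - q| := by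
    rw [sub_mul, hb, hmin p hpy, hmin q hy]
    simpa using abs_min_sub_min_le_max p ‖y‖ q ‖y‖
  have hmain : |(a - b) * ‖y‖| ≤ ‖x - y‖ + |p - q| := by
    have : (a - b) * ‖y‖ = (a - p / max p ‖y‖) * ‖y‖ + (p / max p ‖y‖ - b) * ‖y‖ := by ring
    rw [this]
    exact (abs_add_le _ _).trans (add_le_add hsame hdiff)
  have hsplit : a • x - b • y = a • (x - y) + (a - b) • y := by
    module
  calc ‖a • x - b • y‖ ≤ ‖a • (x - y)‖ + ‖(a - b) • y‖ := hsplit ▸ norm_add_le _ _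
    _ = a * ‖x - y‖ + |(a - b) * ‖y‖| := by
      rw [norm_smul, norm_smul, Real.norm_of_nonneg ha0, abs_mul, abs_norm, Real.norm_eq_abs]
    _ ≤ 1 * ‖x - y‖ + (‖x - y‖ + |p - q|) :=
      add_le_add (mul_le_mul_of_nonneg_right ha1 (norm_nonneg _)) hmain
    _ = _ := by ring

/-- A starlike set can be shrunk radially, near itself, without increasing much the distances
of pairs in a relation that is controlled near the set. -/
theorem exists_radial_shrinking {E : Type*} [NormedAddCommGroup E] [NormedSpace ℝ E]
    {K : Set E} (hK : IsCompact K) (h0 : (0 : E) ∈ K) (hstar : StarConvex ℝ 0 K)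
    {R : E → E → Prop} (hsymm : ∀ x y, R x y → R y x)
    (hR : ∀ r : ℝ, 0 < r → ∃ s : ℝ, 0 < s ∧
      ∀ x y, R x y → Metric.infDist x K < s → Metric.infDist y K < r)
    {r δ : ℝ} (hr : 0 < r) (hδ : 0 < δ) :
    ∃ h : E → E, Continuous h ∧ Function.Bijective h ∧ (∀ x, r ≤ Metric.infDist x K → h x = x) ∧
      (∀ x ∈ K, ‖h x‖ ≤ δ) ∧ ∀ x y, R x y → dist (h x) (h y) ≤ 3 * dist x y + δ := by
  obtain ⟨M, hM⟩ := hK.isBounded.exists_norm_le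
  have hM0 : 0 ≤ M := (norm_nonneg _).trans (hM 0 h0)
  let ε := δ / 2
  have hε : 0 < ε := half_pos hδ
  obtain ⟨j, hj⟩ := exists_nat_gt (M / (ε / 2))
  rw [div_lt_iff₀ (half_pos hε)] at hj
  obtain ⟨σ, s, hs, -, hσc, hσm, hσ0, hσr, hσQ, -⟩ := exists_monotone_slowly_increasing
    (Q := fun a b => ∃ x y, R x y ∧ a = Metric.infDist x K ∧ b = Metric.infDist y K)
    (fun r hr => by
      obtain ⟨s, hs, h⟩ := hR r hr
      refine ⟨s, hs, ?_⟩
      rintro _ _ ⟨x, y, hxy, rfl, rfl⟩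
      exact h x y hxy) hr (half_pos hε) j
  let d : E → ℝ := fun x => Metric.infDist x K
  have hdc : Continuous d := Metric.continuous_infDist_pt K
  have hd0 : ∀ x, 0 ≤ d x := fun x => Metric.infDist_nonneg
  have hσnn : ∀ x, 0 ≤ σ (d x) := fun x => (hσ0 0 hs.le).ge.trans (hσm (hd0 x))
  let ρ : E → ℝ := fun x => ε + σ (d x) + d x
  have hρc : Continuous ρ := by fun_prop
  have hρpos : ∀ x, 0 < ρ x := fun x => by
    have := hd0 x
    have := hσnn x
    simp only [ρ]
    linarith
  have hmax : ∀ x, 0 < max (ρ x) ‖x‖ := fun x => (hρpos x).trans_le (le_max_left _ _)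
  have hρray : ∀ x, ∀ τ : ℝ, 0 < τ → τ < 1 → ρ (τ • x) ≤ ρ x := fun x τ hτ hτ1 => by
    have h1 : d (τ • x) ≤ d x := infDist_smul_le_of_starConvex hstar hτ.le hτ1.le x
    have h2 := hσm h1
    simp only [ρ]
    linarith
  let t : ℝ := min (1 / 2) (ε / (M + 1))
  have ht0 : 0 < t := lt_min (by norm_num) (by positivity)
  have ht1 : t ≤ 1 := (min_le_left _ _).trans (by norm_num)
  have htM : t * M ≤ ε := by
    have h1 : t * (M + 1) ≤ ε := (le_div_iff₀ (by positivity)).1 (min_le_right _ _)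
    linarith
  let c : E → ℝ := fun x => (1 - t) * (ρ x / max (ρ x) ‖x‖) + t
  have hcc : Continuous c := by
    have : Continuous fun x => ρ x / max (ρ x) ‖x‖ :=
      hρc.div (hρc.max continuous_norm) fun x => (hmax x).ne'
    fun_prop
  refine ⟨fun x => c x • x, by fun_prop, bijective_smul_of_strictMono_rays hcc ht0 ?_ ?_,
    ?_, ?_, ?_⟩
  · intro x
    have : 0 ≤ (1 - t) * (ρ x / max (ρ x) ‖x‖) :=
      mul_nonneg (by linarith) (div_pos (hρpos x) (hmax x)).le
    simp only [c]
    linarith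
  · intro x hx τ hτ hτ1
    have hN : 0 < ‖x‖ := norm_pos_iff.2 hx
    have h1 : ρ (τ • x) / max (ρ (τ • x)) ‖τ • x‖ * τ ≤ ρ x / max (ρ x) ‖x‖ := by
      rw [div_mul_eq_mul_div, div_le_div_iff₀ (hmax _) (hmax _), norm_smul,
        Real.norm_of_nonneg hτ.le]
      rcases max_cases (ρ x) ‖x‖ with ⟨h, -⟩ | ⟨h, -⟩
      · rw [h, mul_comm]
        refine mul_le_mul_of_nonneg_left ((mul_le_of_le_one_right (hρpos _).le hτ1.le).trans
          (le_max_left _ _)) (hρpos x).le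
      · rw [h, mul_assoc]
        exact mul_le_mul (hρray x τ hτ hτ1) (le_max_right _ _) (by positivity) (hρpos x).le
    have h2 := mul_le_mul_of_nonneg_left h1 (sub_nonneg.2 ht1)
    have h3 : t * τ < t := mul_lt_of_lt_one_right ht0 hτ1
    simp only [c]
    linarith
  · intro x hx
    obtain ⟨y, hy, hxy⟩ := hK.exists_infDist_eq_dist ⟨0, h0⟩ x
    have h1 : ‖x‖ ≤ ‖y‖ + dist x y := by
      rw [dist_eq_norm]
      simpa using norm_add_le y (x - y)
    have h2 := hM y hy
    have h3 : ‖x‖ ≤ ρ x := by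
      simp only [ρ, d, hσr _ hx]
      linarith
    have h4 : c x = 1 := by
      simp only [c, max_eq_left h3, div_self (hρpos x).ne']
      ring
    simp only [h4, one_smul]
  · intro x hx
    have h1 : ρ x = ε := by
      simp [ρ, d, Metric.infDist_zero_of_mem hx, hσ0 0 hs.le]
    have h2 : ρ x / max (ρ x) ‖x‖ * ‖x‖ ≤ ε := by
      rw [div_mul_eq_mul_div, div_le_iff₀ (hmax x), h1]
      exact mul_le_mul_of_nonneg_left (le_max_right _ _) hε.le
    have h3 := mul_le_mul_of_nonneg_left (hM x hx) ht0.le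
    have h4 : 0 ≤ ρ x / max (ρ x) ‖x‖ * ‖x‖ := by
      have := hρpos x
      have := hmax x
      positivity
    have h5 : 0 ≤ c x := by
      have := (div_pos (hρpos x) (hmax x)).le
      exact add_nonneg (mul_nonneg (sub_nonneg.2 ht1) this) ht0.le
    rw [norm_smul, Real.norm_of_nonneg h5]
    have h6 : c x * ‖x‖ = (1 - t) * (ρ x / max (ρ x) ‖x‖ * ‖x‖) + t * ‖x‖ := by
      simp only [c]
      ring
    have h7 : (1 - t) * (ρ x / max (ρ x) ‖x‖ * ‖x‖) ≤ ρ x / max (ρ x) ‖x‖ * ‖x‖ :=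
      mul_le_of_le_one_left h4 (by linarith)
    have h8 : ε + ε = δ := add_halves δ
    linarith
  · intro x y hxy
    have h1 : |d x - d y| ≤ dist x y := by
      have := (Metric.lipschitz_infDist_pt K).dist_le_mul x y
      simpa [Real.dist_eq] using this
    have h2 := hσQ _ _ ⟨x, y, hxy, rfl, rfl⟩
    have h3 := hσQ _ _ ⟨y, x, hsymm _ _ hxy, rfl, rfl⟩
    have h4 : |ρ x - ρ y| ≤ dist x y + ε := by
      rw [abs_le] at h1 ⊢
      simp only [ρ]
      constructor <;> linarith
    have h5 := norm_truncate_sub_truncate_le (hρpos x) (hρpos y) x y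
    have h6 : c x • x - c y • y = (1 - t) • ((ρ x / max (ρ x) ‖x‖) • x -
        (ρ y / max (ρ y) ‖y‖) • y) + t • (x - y) := by
      simp only [c]
      module
    have h7 := norm_add_le ((1 - t) • ((ρ x / max (ρ x) ‖x‖) • x -
        (ρ y / max (ρ y) ‖y‖) • y)) (t • (x - y))
    rw [← h6, norm_smul, norm_smul, Real.norm_of_nonneg (sub_nonneg.2 ht1),
      Real.norm_of_nonneg ht0.le, ← dist_eq_norm, ← dist_eq_norm x y] at h7
    rw [← dist_eq_norm x y] at h5
    have h8 : 0 ≤ dist x y := dist_nonneg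
    have h9 : 0 ≤ |ρ x - ρ y| := abs_nonneg _
    have h10 := mul_le_mul_of_nonneg_left h5 (sub_nonneg.2 ht1)
    have h11 := mul_nonneg ht0.le h8
    have h12 := mul_nonneg ht0.le h9
    have h13 : ε + ε = δ := add_halves δ
    linarith

/-- Near a compact subset of the domain of a chart, members of a null collection disjoint from it
lie in the domain, and have images which are small and near the image of the set. -/
theorem IsNullCollection.exists_infDist_lt_chart {X E : Type*} [MetricSpace X] [CompactSpace X]
    [MetricSpace E] [ProperSpace E] {𝒢 : Set (Set X)} (hnull : IsNullCollection 𝒢)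
    (φ : OpenPartialHomeomorph X E) {A : Set X} (hA : A ⊆ φ.source) (hne : A.Nonempty)
    (hK : IsCompact (φ '' A)) (h𝒢 : ∀ G ∈ 𝒢, IsClosed G ∧ Disjoint G A) {r η : ℝ} (hr : 0 < r)
    (hη : 0 < η) :
    ∃ s : ℝ, 0 < s ∧ ∀ G ∈ 𝒢, ∀ x ∈ G, x ∈ φ.source → Metric.infDist (φ x) (φ '' A) < s →
      ∀ y ∈ G, y ∈ φ.source ∧ Metric.infDist (φ y) (φ '' A) < r ∧ dist (φ x) (φ y) < η := by
  have hKt : φ '' A ⊆ φ.target := by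
    rintro _ ⟨a, ha, rfl⟩
    exact φ.map_source (hA ha)
  have hKne : (φ '' A).Nonempty := hne.image φ
  obtain ⟨r₀, hr₀, hr₀t⟩ := hK.exists_cthickening_subset_open φ.open_target hKt
  let r₁ := min (r / 2) r₀
  have hr₁ : 0 < r₁ := lt_min (half_pos hr) hr₀
  have hct : cthickening r₁ (φ '' A) ⊆ φ.target :=
    (cthickening_mono (min_le_right _ _) _).trans hr₀t
  let N := φ.symm '' cthickening r₁ (φ '' A)
  have hN : IsCompact N := hK.cthickening.image_of_continuousOn (φ.continuousOn_symm.mono hct)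
  have hNs : N ⊆ φ.source := by
    rintro _ ⟨u, hu, rfl⟩
    exact φ.map_target (hct hu)
  obtain ⟨ε₁, hε₁, hε₁s⟩ := hN.exists_thickening_subset_open φ.open_source hNs
  obtain ⟨ε₂, hε₂, hε₂φ⟩ := Metric.mem_uniformity_dist.1
    (hN.uniformContinuousAt_of_continuousAt φ (fun x hx => φ.continuousAt (hNs hx))
      (Metric.dist_mem_uniformity (lt_min hη (half_pos hr))))
  obtain ⟨O, hO, hAO, hO𝒢⟩ := hnull.exists_isOpen_diam_lt h𝒢 (lt_min hε₁ hε₂)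
  obtain ⟨s, hs, hsO⟩ := hK.exists_thickening_subset_open (φ.isOpen_inter_preimage_symm hO) (by
    rintro _ ⟨a, ha, rfl⟩
    refine ⟨φ.map_source (hA ha), ?_⟩
    rw [mem_preimage, φ.left_inv (hA ha)]
    exact hAO ha)
  refine ⟨min s r₁, lt_min hs hr₁, fun G hG x hx hxs hxK y hy => ?_⟩
  have hxO : x ∈ O := by
    have := (hsO ((mem_thickening_iff_infDist_lt hKne).2 (hxK.trans_le (min_le_left _ _)))).2
    rwa [mem_preimage, φ.left_inv hxs] at this
  have hxy : dist x y < min ε₁ ε₂ :=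
    (Metric.dist_le_diam_of_mem (Metric.isBounded_of_compactSpace) hx hy).trans_lt
      (hO𝒢 G hG x hx hxO)
  have hxN : x ∈ N := by
    refine ⟨φ x, thickening_subset_cthickening _ _ ((mem_thickening_iff_infDist_lt hKne).2
      (hxK.trans_le (min_le_right _ _))), φ.left_inv hxs⟩
  have hφ : dist (φ x) (φ y) < min η (r / 2) := hε₂φ (hxy.trans_le (min_le_right _ _)) hxN
  refine ⟨hε₁s (mem_thickening_iff.2 ⟨x, hxN, ?_⟩), ?_, hφ.trans_le (min_le_left _ _)⟩
  · rw [dist_comm]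
    exact hxy.trans_le (min_le_left _ _)
  · have h1 := Metric.infDist_le_infDist_add_dist (s := φ '' A) (x := φ y) (y := φ x)
    have h2 := hφ.trans_le (min_le_right _ _)
    have h3 := hxK.trans_le ((min_le_right _ _).trans (min_le_left _ _))
    rw [dist_comm] at h1
    linarith

/-- A continuous bijection of the target of a chart, supported in a compact subset of the target,
extends by the identity to a homeomorphism. -/
theorem OpenPartialHomeomorph.exists_homeomorph_extending {X E : Type*} [TopologicalSpace X]
    [CompactSpace X] [T2Space X] [TopologicalSpace E] (φ : OpenPartialHomeomorph X E) {M : Set E}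
    (hM : IsCompact M) (hMt : M ⊆ φ.target) {h : E → E} (hc : Continuous h)
    (hb : Function.Bijective h) (hid : ∀ u ∉ M, h u = u) :
    ∃ H : X ≃ₜ X, (∀ x ∈ φ.source, H x = φ.symm (h (φ x))) ∧
      ∀ x, (x ∈ φ.source → φ x ∉ M) → H x = x := by
  classical
  have hmaps : ∀ u ∈ φ.target, h u ∈ φ.target := by
    intro u hu
    by_contra hn
    have h1 := hid (h u) fun hn' => hn (hMt hn')
    exact hn (by rwa [hb.1 h1])
  let f : X → X := fun x => if x ∈ φ.source then φ.symm (h (φ x)) else x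
  have hfs : ∀ x ∈ φ.source, f x = φ.symm (h (φ x)) := fun x hx => if_pos hx
  have hfn : ∀ x ∉ φ.source, f x = x := fun x hx => if_neg hx
  have hfid : ∀ x, (x ∈ φ.source → φ x ∉ M) → f x = x := by
    intro x hx
    by_cases hxs : x ∈ φ.source
    · rw [hfs x hxs, hid _ (hx hxs), φ.left_inv hxs]
    · exact hfn x hxs
  have hfmaps : ∀ x ∈ φ.source, f x ∈ φ.source := fun x hx => by
    rw [hfs x hx]
    exact φ.map_target (hmaps _ (φ.map_source hx))
  have hfc : Continuous f := by
    rw [continuous_iff_continuousAt]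
    intro x
    by_cases hx : x ∈ φ.source
    · have h1 : ContinuousAt (fun x => φ.symm (h (φ x))) x :=
        ContinuousAt.comp' (φ.continuousAt_symm (hmaps _ (φ.map_source hx)))
          (hc.continuousAt.comp' (φ.continuousAt hx))
      refine h1.congr ?_
      filter_upwards [φ.open_source.mem_nhds hx] with y hy
      exact (hfs y hy).symm
    · have hP : IsClosed (φ.symm '' M) :=
        (hM.image_of_continuousOn (φ.continuousOn_symm.mono hMt)).isClosed
      have hxP : x ∈ (φ.symm '' M)ᶜ := by
        rintro ⟨u, hu, rfl⟩
        exact hx (φ.map_target (hMt hu))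
      refine continuousAt_id.congr ?_
      filter_upwards [hP.isOpen_compl.mem_nhds hxP] with y hy
      exact (hfid y fun hys hyM => hy ⟨φ y, hyM, φ.left_inv hys⟩).symm
  have hfi : Function.Injective f := by
    intro x y hxy
    by_cases hx : x ∈ φ.source <;> by_cases hy : y ∈ φ.source
    · rw [hfs x hx, hfs y hy] at hxy
      exact φ.injOn hx hy (hb.1 (φ.symm.injOn (hmaps _ (φ.map_source hx))
        (hmaps _ (φ.map_source hy)) hxy))
    · exact absurd (by rw [← hfn y hy, ← hxy]; exact hfmaps x hx) hy
    · exact absurd (by rw [← hfn x hx, hxy]; exact hfmaps y hy) hx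
    · rwa [hfn x hx, hfn y hy] at hxy
  have hfsurj : Function.Surjective f := by
    intro y
    by_cases hy : y ∈ φ.source
    · obtain ⟨u, hu⟩ := hb.2 (φ y)
      have hut : u ∈ φ.target := by
        by_contra hn
        rw [hid u fun hn' => hn (hMt hn')] at hu
        exact hn (hu ▸ φ.map_source hy)
      refine ⟨φ.symm u, ?_⟩
      rw [hfs _ (φ.map_target hut), φ.right_inv hut, hu, φ.left_inv hy]
    · exact ⟨y, hfn y hy⟩
  exact ⟨Continuous.homeoOfEquivCompactToT2 (f := Equiv.ofBijective f ⟨hfi, hfsurj⟩) hfc,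
    hfs, hfid⟩

theorem OpenPartialHomeomorph.isNullShrinkable_of_starConvex {X : Type u} [MetricSpace X]
    [CompactSpace X] {E : Type*} [NormedAddCommGroup E] [NormedSpace ℝ E] [ProperSpace E]
    (φ : OpenPartialHomeomorph X E) {A : Set X} (hA : A ⊆ φ.source) (hK : IsCompact (φ '' A))
    (h0 : (0 : E) ∈ φ '' A) (hstar : StarConvex ℝ 0 (φ '' A)) : IsNullShrinkable A := by
  intro 𝒢 hnull h𝒢 U hU hAU δ hδ
  have hKne : (φ '' A).Nonempty := ⟨0, h0⟩
  have hne : A.Nonempty := hKne.of_image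
  obtain ⟨r₀, hr₀, hr₀W⟩ := hK.exists_cthickening_subset_open
    (φ.isOpen_inter_preimage_symm hU) (by
      rintro _ ⟨a, ha, rfl⟩
      refine ⟨φ.map_source (hA ha), ?_⟩
      rw [mem_preimage, φ.left_inv (hA ha)]
      exact hAU ha)
  set M := cthickening r₀ (φ '' A) with hMdef
  have hM : IsCompact M := hK.cthickening
  have hMt : M ⊆ φ.target := fun u hu => (hr₀W hu).1
  have hmemM : ∀ u, Metric.infDist u (φ '' A) < r₀ → u ∈ M := fun u hu =>
    thickening_subset_cthickening _ _ ((mem_thickening_iff_infDist_lt hKne).2 hu)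
  obtain ⟨η, hη, hηδ⟩ := Metric.uniformContinuousOn_iff.1
    (hM.uniformContinuousOn_of_continuous (φ.continuousOn_symm.mono hMt)) δ hδ
  obtain ⟨s, hs, hs𝒢⟩ := hnull.exists_infDist_lt_chart φ hA hne hK h𝒢 hr₀
    (show 0 < η / 18 by positivity)
  obtain ⟨h, hc, hb, hid, hhK, hhR⟩ := exists_radial_shrinking hK h0 hstar
    (R := fun u v => ∃ G ∈ 𝒢, ∃ x ∈ G, ∃ y ∈ G, x ∈ φ.source ∧ y ∈ φ.source ∧
      φ x = u ∧ φ y = v)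
    (by
      rintro _ _ ⟨G, hG, x, hx, y, hy, hxs, hys, rfl, rfl⟩
      exact ⟨G, hG, y, hy, x, hx, hys, hxs, rfl, rfl⟩)
    (by
      intro r hr
      obtain ⟨s, hs, hs𝒢⟩ := hnull.exists_infDist_lt_chart φ hA hne hK h𝒢 hr one_pos
      refine ⟨s, hs, ?_⟩
      rintro _ _ ⟨G, hG, x, hx, y, hy, hxs, -, rfl, rfl⟩ hlt
      exact (hs𝒢 G hG x hx hxs hlt y hy).2.1)
    (lt_min hs hr₀) (show 0 < η / 3 by positivity)
  have hidM : ∀ u ∉ M, h u = u := fun u hu =>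
    hid u ((min_le_right _ _).trans (not_lt.1 fun hlt => hu (hmemM u hlt)))
  have hmapsM : ∀ u ∈ M, h u ∈ M := by
    intro u hu
    by_contra hn
    exact hn (by rwa [hb.1 (hidM _ hn)])
  obtain ⟨H, hHs, hHid⟩ := φ.exists_homeomorph_extending hM hMt hc hb hidM
  have hsmall : ∀ x ∈ φ.source, ∀ y ∈ φ.source, φ x ∈ M → φ y ∈ M →
      dist (h (φ x)) (h (φ y)) < η → dist (H x) (H y) ≤ δ := by
    intro x hx y hy hxM hyM hlt
    rw [hHs x hx, hHs y hy]
    exact (hηδ _ (hmapsM _ hxM) _ (hmapsM _ hyM) hlt).le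
  refine ⟨H, fun x hx => hHid x fun hxs hxM => hx ?_, ?_, fun G hG => ?_⟩
  · have := (hr₀W hxM).2
    rwa [mem_preimage, φ.left_inv hxs] at this
  · refine Metric.diam_le_of_forall_dist_le hδ.le ?_
    rintro _ ⟨x, hx, rfl⟩ _ ⟨y, hy, rfl⟩
    refine hsmall x (hA hx) y (hA hy) (self_subset_cthickening _ (mem_image_of_mem φ hx))
      (self_subset_cthickening _ (mem_image_of_mem φ hy)) ?_
    have h1 := hhK _ (mem_image_of_mem φ hx)
    have h2 := hhK _ (mem_image_of_mem φ hy)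
    have h3 := dist_le_norm_add_norm (h (φ x)) (h (φ y))
    linarith
  · by_cases hGx : ∃ x ∈ G, x ∈ φ.source ∧ Metric.infDist (φ x) (φ '' A) < min s r₀
    · obtain ⟨x, hx, hxs, hxK⟩ := hGx
      have hall := hs𝒢 G hG x hx hxs (hxK.trans_le (min_le_left _ _))
      refine (Metric.diam_le_of_forall_dist_le hδ.le ?_).trans
        (le_add_of_nonneg_left Metric.diam_nonneg)
      rintro _ ⟨y, hy, rfl⟩ _ ⟨z, hz, rfl⟩
      obtain ⟨hys, hyK, hy18⟩ := hall y hy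
      obtain ⟨hzs, hzK, hz18⟩ := hall z hz
      refine hsmall y hys z hzs (hmemM _ hyK) (hmemM _ hzK) ?_
      have h1 := hhR _ _ ⟨G, hG, y, hy, z, hz, hys, hzs, rfl, rfl⟩
      have h2 := dist_triangle_left (φ y) (φ z) (φ x)
      linarith
    · have : H '' G = G := by
        rw [show H '' G = id '' G from image_congr fun x hx => ?_, image_id]
        by_cases hxs : x ∈ φ.source
        · rw [hHs x hxs, hid _ (not_lt.1 fun hlt => hGx ⟨x, hx, hxs, hlt⟩), φ.left_inv hxs, id]
        · exact hHid x fun hxs' => absurd hxs' hxs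
      rw [this]
      linarith

theorem IsStarlikeEquivalent.isNullShrinkable {X : Type u} [MetricSpace X] [CompactSpace X]
    {A : Set X} (hA : IsStarlikeEquivalent A) : IsNullShrinkable A := by
  obtain ⟨n, -, U, hU, hAU, e, he, hr, hcpt, c, hc, hseg⟩ := hA
  have : Nonempty U := by
    obtain ⟨x, -, -⟩ := hc
    exact ⟨x⟩
  let φ : OpenPartialHomeomorph X (EuclideanSpace ℝ (Fin n)) :=
    ((hU.isOpenEmbedding_subtypeVal.toOpenPartialHomeomorph Subtype.val).symm.trans
      ((⟨he, hr⟩ : Topology.IsOpenEmbedding e).toOpenPartialHomeomorph e)).transHomeomorph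
        (Homeomorph.addRight (-c))
  have hsource : φ.source = U := by
    simp [φ]
  have hφ : ∀ x : U, φ x = e x - c := by
    intro x
    have h1 := (hU.isOpenEmbedding_subtypeVal.toOpenPartialHomeomorph Subtype.val).left_inv
      (x := x) (by simp)
    have h2 : φ x = e ((hU.isOpenEmbedding_subtypeVal.toOpenPartialHomeomorph
      Subtype.val).symm x) - c := by
      simp [φ, sub_eq_add_neg]
    rw [h2]
    exact congrArg (fun y => e y - c) h1
  have himage : φ '' A = (fun u => u - c) '' (e '' {x : U | (x : X) ∈ A}) := by
    ext u
    constructor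
    · rintro ⟨a, ha, rfl⟩
      exact ⟨_, ⟨⟨a, hAU ha⟩, ha, rfl⟩, (hφ ⟨a, hAU ha⟩).symm⟩
    · rintro ⟨_, ⟨a, ha, rfl⟩, rfl⟩
      exact ⟨a, ha, hφ a⟩
  refine φ.isNullShrinkable_of_starConvex (hsource ▸ hAU) ?_ ?_ ?_
  · rw [himage]
    exact hcpt.image (by fun_prop)
  · rw [himage]
    exact ⟨c, hc, sub_self c⟩
  · rw [himage, starConvex_iff_segment_subset]
    rintro _ ⟨y, hy, rfl⟩
    have h1 : segment ℝ 0 (y - c) = (fun u => u - c) '' segment ℝ c y := by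
      simpa [sub_eq_add_neg, add_comm] using (segment_translate_image ℝ (-c) c y).symm
    rw [h1]
    exact image_mono (hseg y hy)

theorem IsStarlikeEquivalent.nonempty {X : Type u} [TopologicalSpace X] {A : Set X}
    (hA : IsStarlikeEquivalent A) : A.Nonempty := by
  obtain ⟨-, -, U, -, -, e, -, -, -, -, ⟨x, hx, -⟩, -⟩ := hA
  exact ⟨x, hx⟩

theorem IsStarlikeEquivalent.image {X : Type u} {Y : Type v} [TopologicalSpace X]
    [TopologicalSpace Y] {A : Set X} (hA : IsStarlikeEquivalent A) (h : X ≃ₜ Y) :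
    IsStarlikeEquivalent (h '' A) := by
  obtain ⟨n, hn, U, hU, hAU, e, he, hr, hs⟩ := hA
  refine ⟨n, hn, h '' U, h.isOpenMap U hU, image_mono hAU, e ∘ (h.image U).symm,
    he.comp (h.image U).symm.isEmbedding, ?_, ?_⟩
  · rwa [(h.image U).symm.surjective.range_comp]
  · have : {x : h '' U | (x : Y) ∈ h '' A} = h.image U '' {x : U | (x : X) ∈ A} := by
      ext ⟨_, x, hx, rfl⟩
      constructor
      · rintro ⟨a, ha, hax⟩
        obtain rfl := h.injective hax
        exact ⟨⟨a, hx⟩, ha, rfl⟩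
      · rintro ⟨a, ha, hax⟩
        exact ⟨a, ha, congrArg Subtype.val hax⟩
    rw [this, ← image_comp]
    convert hs using 2
    ext1 x
    simp

theorem StarlikeEquivalentInQuotient.image {X : Type u} [MetricSpace X] [CompactSpace X]
    {B A : Set X} (hA : StarlikeEquivalentInQuotient B A) {f : X → X} (hf : Continuous f)
    (hsurj : Function.Surjective f) (hfib : ∀ x y, f x = f y → x = y ∨ (x ∈ B ∧ y ∈ B)) :
    StarlikeEquivalentInQuotient (f '' B) (f '' A) := by
  obtain ⟨Z, mZ, p, hp, hpsurj, hpfib, hpA⟩ := hA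
  have hfac : ∀ x, p (Function.surjInv hsurj (f x)) = p x := fun x =>
    (hpfib _ _).2 (hfib _ _ (Function.surjInv_eq hsurj (f x)))
  refine ⟨Z, mZ, p ∘ Function.surjInv hsurj, ?_, ?_, ?_, ?_⟩
  · rw [(hf.isClosedMap.isQuotientMap hf hsurj).continuous_iff]
    exact hp.congr fun x => (hfac x).symm
  · intro z
    obtain ⟨x, rfl⟩ := hpsurj z
    exact ⟨f x, hfac x⟩
  · intro x y
    obtain ⟨x, rfl⟩ := hsurj x
    obtain ⟨y, rfl⟩ := hsurj y
    simp only [comp_apply, hfac, hpfib]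
    constructor
    · rintro (rfl | ⟨hx, hy⟩)
      · exact Or.inl rfl
      · exact Or.inr ⟨mem_image_of_mem f hx, mem_image_of_mem f hy⟩
    · rintro (hxy | ⟨⟨x', hx, hxx⟩, ⟨y', hy, hyy⟩⟩)
      · exact hfib _ _ hxy
      · refine Or.inr ⟨?_, ?_⟩
        · rcases hfib _ _ hxx with rfl | h
          exacts [hx, h.2]
        · rcases hfib _ _ hyy with rfl | h
          exacts [hy, h.2]
  · rw [← image_comp]
    rwa [show (p ∘ Function.surjInv hsurj) ∘ f = p from funext hfac]

theorem RecursivelyStarlikeEquivalentOfLength.isNullShrinkable {X : Type u} [MetricSpace X]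
    [CompactSpace X] {n : ℕ} {A : Set X} (hA : RecursivelyStarlikeEquivalentOfLength n A) :
    IsNullShrinkable A := by
  induction n generalizing A with
  | zero =>
    obtain ⟨F, -, -, rfl, h0, -⟩ := hA
    exact h0.isNullShrinkable
  | succ n ih =>
    obtain ⟨F, hcpt, hmono, rfl, h0, hstep⟩ := hA
    obtain ⟨Y, mY, π, hπ, hsurj, hfib, hSE⟩ := hstep 0
    have : CompactSpace Y := hsurj.compactSpace hπ
    refine h0.isNullShrinkable.of_quotient h0.nonempty (hmono (Fin.zero_le _)) hπ hsurj hfib ?_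
    intro g
    have hf : Continuous fun x => g.symm (π x) := g.symm.continuous.comp hπ
    refine ih ⟨fun i => (fun x => g.symm (π x)) '' F i.succ, fun i => (hcpt _).image hf,
      fun i j hij => image_mono (hmono (Fin.succ_le_succ_iff.2 hij)), rfl, ?_, fun i => ?_⟩
    · have := hSE.image g.symm
      rwa [← image_comp] at this
    · refine (hstep i.succ).image hf (g.symm.surjective.comp hsurj) fun x y hxy => ?_
      rcases (hfib x y).1 (g.symm.injective hxy) with h | ⟨hx, hy⟩
      · exact Or.inl h
      · exact Or.inr ⟨hmono (Fin.zero_le _) hx, hmono (Fin.zero_le _) hy⟩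

open Filter Topology in
/-- A map whose point preimages form a null collection, with each of the nondegenerate ones
shrinkable, satisfies the strong shrinking criterion. -/
theorem satisfiesStrongShrinkingCriterion_of_isNullShrinkable {X : Type u} {Y : Type v}
    [MetricSpace X] [CompactSpace X] [MetricSpace Y] {π : X → Y} (hπ : Continuous π)
    (hsurj : Function.Surjective π)
    (hnull : IsNullCollection (range fun y => π ⁻¹' {y}))
    (hshrink : ∀ y, 0 < Metric.diam (π ⁻¹' {y}) → IsNullShrinkable (π ⁻¹' {y})) :
    SatisfiesStrongShrinkingCriterion π := by
  intro δ hδ C hC hinj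
  let T : Set Y := {y | δ / 2 ≤ Metric.diam (π ⁻¹' {y})}
  have hT : T.Finite := by
    refine Set.Finite.of_finite_image (f := fun y => π ⁻¹' {y})
      ((hnull (δ / 2) (half_pos hδ)).subset ?_) ?_
    · rintro _ ⟨y, hy, rfl⟩
      exact ⟨mem_range_self y, hy⟩
    · intro y _ z _ (hyz : π ⁻¹' {y} = π ⁻¹' {z})
      obtain ⟨x, rfl⟩ := hsurj y
      have : x ∈ π ⁻¹' {z} := by
        rw [← hyz]
        rfl
      exact this
  have key : ∀ S : Set Y, S.Finite → S ⊆ T → ∃ h : X ≃ₜ X, (∀ x, π x ∈ C → h x = x) ∧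
      (∀ x, dist (π (h x)) (π x) < δ) ∧ (∀ y ∈ T \ S, ∀ᶠ z in 𝓝 y, ∀ x, π x = z → h x = x) ∧
      ∀ y, (y ∈ S ∨ y ∉ T) → Metric.diam (h '' (π ⁻¹' {y})) < δ := by
    intro S hS
    induction S, hS using Set.Finite.induction_on with
    | empty =>
      intro _
      refine ⟨Homeomorph.refl X, fun x _ => rfl, fun x => by simpa using hδ,
        fun y _ => Eventually.of_forall fun z x _ => rfl, fun y hy => ?_⟩
      have : Metric.diam (π ⁻¹' {y}) < δ / 2 := not_le.1 (hy.resolve_left (notMem_empty y))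
      rw [show Homeomorph.refl X '' (π ⁻¹' {y}) = π ⁻¹' {y} from image_id _]
      linarith
    | @insert y₀ S hy₀ hS ih =>
      intro hST
      obtain ⟨h, hhC, hhπ, hhT, hhd⟩ := ih ((subset_insert _ _).trans hST)
      have hy₀T : y₀ ∈ T := hST (mem_insert _ _)
      have hpos : 0 < Metric.diam (π ⁻¹' {y₀}) := (half_pos hδ).trans_le hy₀T
      have hy₀C : y₀ ∉ C := by
        intro hyC
        refine hpos.ne' (Metric.diam_subsingleton fun x hx x' hx' => ?_)
        have hx : π x = y₀ := hx
        have hx' : π x' = y₀ := hx'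
        exact hinj (show π x ∈ C by rwa [hx]) (show π x' ∈ C by rwa [hx']) (hx.trans hx'.symm)
      have hy₀' : y₀ ∈ (T \ {y₀})ᶜ := fun hn => hn.2 rfl
      have hev : ∀ᶠ z in 𝓝 y₀, z ∉ C ∧ z ∉ T \ {y₀} ∧ ∀ x, π x = z → h x = x :=
        (hC.isOpen_compl.eventually_mem hy₀C).and
          (((hT.subset sdiff_subset).isClosed.isOpen_compl.eventually_mem hy₀').and
            (hhT y₀ ⟨hy₀T, hy₀⟩))
      obtain ⟨R, hR, hRy⟩ := Metric.nhds_basis_closedBall.eventually_iff.1 hev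
      let r := min R (δ / 2)
      have hr : 0 < r := lt_min hR (half_pos hδ)
      have hrδ : r ≤ δ / 2 := min_le_right _ _
      have hball : ∀ {z}, z ∈ ball y₀ r → z ∈ closedBall y₀ R := fun {z} hz =>
        closedBall_subset_closedBall (min_le_left _ _) (ball_subset_closedBall hz)
      obtain ⟨k, hkV, hkd, hk𝒢⟩ := hshrink y₀ hpos ((fun y => π ⁻¹' {y}) '' {y₀}ᶜ)
        (fun ε hε => (hnull ε hε).subset fun G hG => ⟨image_subset_range _ _ hG.1, hG.2⟩)
        (by
          rintro _ ⟨y, hy, rfl⟩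
          exact ⟨isClosed_singleton.preimage hπ,
            (disjoint_singleton.2 hy).preimage π⟩) (π ⁻¹' ball y₀ r) (isOpen_ball.preimage hπ)
        (preimage_mono (singleton_subset_iff.2 (mem_ball_self hr))) (δ / 4) (by positivity)
      have hin : ∀ x, π x ∈ ball y₀ r → π (k x) ∈ ball y₀ r ∧ h (k x) = k x := fun x hx =>
        have h1 : k x ∈ π ⁻¹' ball y₀ r := Homeomorph.apply_mem_of_forall_notMem hkV hx
        ⟨h1, (hRy (hball h1)).2.2 _ rfl⟩
      refine ⟨k.trans h, fun x hx => ?_, fun x => ?_, fun y hy => ?_, fun y hy => ?_⟩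
      · rw [Homeomorph.trans_apply, hkV x fun hn => (hRy (hball hn)).1 hx, hhC x hx]
      · rw [Homeomorph.trans_apply]
        by_cases hx : π x ∈ ball y₀ r
        · rw [(hin x hx).2]
          have h1 := mem_ball.1 hx
          have h2 := mem_ball.1 (hin x hx).1
          have h3 := dist_triangle_right (π (k x)) (π x) y₀
          linarith
        · rw [hkV x hx]
          exact hhπ x
      · have hne : y ≠ y₀ := fun hn => hy.2 (hn ▸ mem_insert _ _)
        have hnR : y ∉ closedBall y₀ R := fun hn => (hRy hn).2.1 ⟨hy.1, hne⟩
        filter_upwards [hhT y ⟨hy.1, fun hn => hy.2 (mem_insert_of_mem _ hn)⟩,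
          isClosed_closedBall.isOpen_compl.mem_nhds hnR] with z hz hzR x hx
        rw [Homeomorph.trans_apply, hkV x fun hn => hzR (hball (hx ▸ hn)), hz x hx]
      · by_cases hyb : y ∈ ball y₀ r
        · have himage : k.trans h '' (π ⁻¹' {y}) = k '' (π ⁻¹' {y}) := by
            refine image_congr fun x hx => (hin x ?_).2
            have hx : π x = y := hx
            rwa [hx]
          rw [himage]
          by_cases hyy : y = y₀
          · rw [hyy]
            linarith
          · have hyT : y ∉ T := fun hn => (hRy (hball hyb)).2.1 ⟨hn, hyy⟩
            have h1 : Metric.diam (π ⁻¹' {y}) < δ / 2 := not_le.1 hyT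
            have h2 := hk𝒢 _ ⟨y, hyy, rfl⟩
            simp only at h2
            linarith
        · have himage : k.trans h '' (π ⁻¹' {y}) = h '' (π ⁻¹' {y}) := by
            refine image_congr fun x hx => ?_
            have hx : π x = y := hx
            rw [Homeomorph.trans_apply, hkV x fun hn => hyb (hx ▸ hn)]
          rw [himage]
          refine hhd y (hy.imp_left fun hyS => ?_)
          rcases hyS with rfl | hyS
          exacts [absurd (mem_ball_self hr) hyb, hyS]
  obtain ⟨h, hhC, hhπ, -, hhd⟩ := key T hT subset_rfl
  refine ⟨h, fun y => hhd y (em _), fun x => ?_, fun x hx => hhC x hx⟩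
  simpa using hhπ (h.symm x)

theorem SatisfiesStrongShrinkingCriterion.isStrongNearHomeomorphism {X : Type u} {Y : Type v}
    [MetricSpace X] [CompactSpace X] [MetricSpace Y] [CompactSpace Y] {π : X → Y}
    (h : SatisfiesStrongShrinkingCriterion π) (hπ : Continuous π)
    (hsurj : Function.Surjective π) : IsStrongNearHomeomorphism π := by
  intro ε hε C hC hinj
  have hrefl : Homeomorph.refl X ∈ {h : X ≃ₜ X | ∀ x ∈ π ⁻¹' C, h x = x} := fun x _ => rfl
  have hdense : ∀ h ∈ {h : X ≃ₜ X | ∀ x ∈ π ⁻¹' C, h x = x}, ∀ ε : ℝ, 0 < ε →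
      ∃ h' ∈ {h : X ≃ₜ X | ∀ x ∈ π ⁻¹' C, h x = x},
        (∀ x y, π x = π y → dist (h' x) (h' y) < ε) ∧
          ∀ x, dist (π (h'.symm x)) (π (h.symm x)) < ε := by
    intro h₁ hh₁ ε hε
    obtain ⟨η, hη, hhη⟩ := Metric.uniformContinuous_iff.1
      (CompactSpace.uniformContinuous_of_continuous h₁.continuous) ε hε
    obtain ⟨k, hkd, hkπ, hkC⟩ := h (min η ε) (lt_min hη hε) C hC hinj
    refine ⟨k.trans h₁, fun x hx => ?_, fun x y hxy => ?_, fun x => ?_⟩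
    · rw [Homeomorph.trans_apply, hkC x hx, hh₁ x hx]
    · refine hhη ((Metric.dist_le_diam_of_mem (Metric.isBounded_of_compactSpace)
        (mem_image_of_mem k (show x ∈ π ⁻¹' {π y} from hxy))
        (mem_image_of_mem k (show y ∈ π ⁻¹' {π y} from rfl))).trans_lt
          ((hkd _).trans_le (min_le_left _ _)))
    · rw [dist_comm]
      exact (hkπ (h₁.symm x)).trans_le (min_le_right _ _)
  obtain ⟨g, hg, hgH⟩ :=
    exists_homeomorph_approximating_of_shrinking hπ hsurj _ hdense hrefl hε
  refine ⟨g, fun x => ?_, fun x hx => ?_⟩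
  · rw [dist_comm]
    exact hg x
  · by_contra hne
    obtain ⟨h', hh', hclose⟩ := hgH _ (dist_pos.2 hne)
    have := hclose x
    rw [Homeomorph.symm_apply_eq_self (hh' x hx)] at this
    exact lt_irrefl _ this

/-- **Theorem 1.1 of [MOR].** Let `n ≥ 1`. If `𝒢` is a null upper semi-continuous
decomposition of a compact metric space `X` each of whose non-singleton elements is a
recursively starlike-equivalent subset of `X` of filtration length `≤ n`, then `𝒢` is
strongly shrinkable, and the quotient map `π : X → X/𝒢` is a strong near homeomorphism.
The quotient space `X/𝒢`, with a fixed metric inducing the quotient topology, is modelled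
by a compact metric space `Y` together with a continuous surjection `π : X → Y` whose
fibers are exactly the elements of `𝒢`. -/
theorem null_decomposition_recursivelyStarlikeEquivalent_length_le_strongly_shrinkable
    {X : Type u} {Y : Type v} [MetricSpace X] [CompactSpace X] [MetricSpace Y]
    [CompactSpace Y] (n : ℕ) (hn : 1 ≤ n)
    (𝒢 : Set (Set X)) (hdec : IsUSCDecomposition 𝒢) (hnull : IsNullCollection 𝒢)
    (hsq : ∀ G ∈ 𝒢, (¬ ∃ x : X, G = {x}) → RecursivelyStarlikeEquivalentOfLength n G)
    (π : X → Y) (hπ : Continuous π) (hsurj : Function.Surjective π)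
    (hfib : ∀ x y : X, π x = π y ↔ ∃ G ∈ 𝒢, x ∈ G ∧ y ∈ G) :
    SatisfiesStrongShrinkingCriterion π ∧ IsStrongNearHomeomorphism π := by
  have hcell : ∀ G ∈ 𝒢, ∀ x ∈ G, π ⁻¹' {π x} = G := by
    intro G hG x hx
    ext z
    rw [mem_preimage, mem_singleton_iff, hfib]
    constructor
    · rintro ⟨G', hG', hz, hx'⟩
      rwa [(hdec.2.1 x).unique ⟨hG, hx⟩ ⟨hG', hx'⟩]
    · exact fun hz => ⟨G, hG, hz, hx⟩
  have hmem : ∀ y, π ⁻¹' {y} ∈ 𝒢 := by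
    intro y
    obtain ⟨x, rfl⟩ := hsurj y
    obtain ⟨G, ⟨hG, hx⟩, -⟩ := hdec.2.1 x
    rwa [hcell G hG x hx]
  have hcrit : SatisfiesStrongShrinkingCriterion π := by
    refine satisfiesStrongShrinkingCriterion_of_isNullShrinkable hπ hsurj
      (fun ε hε => (hnull ε hε).subset ?_) fun y hy => (hsq _ (hmem y) ?_).isNullShrinkable
    · rintro _ ⟨⟨y, rfl⟩, hy⟩
      exact ⟨hmem y, hy⟩
    · rintro ⟨x, hx⟩
      rw [hx, Metric.diam_singleton] at hy
      exact lt_irrefl _ hy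
  exact ⟨hcrit, hcrit.isStrongNearHomeomorphism hπ hsurj⟩
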